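/- Fix a real number κ and a real x₀ > 0, and suppose F : ℂ → ℂ is an entire function such that F(μ) = W_{κ,μ}(x₀) for every complex μ with 2μ not an integer. Then all zeros of F are simple except for a possible double zero at μ = 0: if F(ρ) = 0 and ρ ≠ 0 then F'(ρ) ≠ 0, and if F(0) = 0 then F''(0) ≠ 0. -/

import Mathlib

/-- The Whittaker M-function `M_{κ,μ}(x)` for real `x > 0`, defined by its series. -/
noncomputable def whittakerM (κ μ : ℂ) (x : ℝ) : ℂ :=
  Complex.exp (-(x:ℂ)/2) * Complex.exp ((1/2 + μ) * (Real.log x : ℂ)) *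
    ∑' j : ℕ, (Polynomial.eval (1/2 - κ + μ) (ascPochhammer ℂ j)) /
      ((Polynomial.eval (2*μ + 1) (ascPochhammer ℂ j)) * (Nat.factorial j : ℂ)) * (x:ℂ)^j

/-- The Whittaker W-function `W_{κ,μ}(x)` for real `x > 0` and `2μ` not an integer. -/
noncomputable def whittakerW (κ μ : ℂ) (x : ℝ) : ℂ :=
  Complex.Gamma (-(2*μ)) / Complex.Gamma (1/2 - κ - μ) * whittakerM κ μ x +
  Complex.Gamma (2*μ) / Complex.Gamma (1/2 - κ + μ) * whittakerM κ (-μ) x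

/-- Exponential generating series. -/
noncomputable def expSer (c : ℕ → ℂ) (z : ℂ) : ℂ := ∑' j : ℕ, c j * z ^ j / (Nat.factorial j : ℂ)

/-- At most geometric growth. -/
def GeomBdd (c : ℕ → ℂ) : Prop := ∃ A R : ℝ, 0 ≤ A ∧ 0 ≤ R ∧ ∀ j, ‖c j‖ ≤ A * R ^ j

theorem GeomBdd.shift {c : ℕ → ℂ} (h : GeomBdd c) : GeomBdd (fun j => c (j+1)) := by
  obtain ⟨A, R, hA, hR, h⟩ := h
  refine ⟨A * R, R, by positivity, hR, fun j => (h (j+1)).trans (le_of_eq ?_)⟩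
  ring

theorem expSer_term_le {c : ℕ → ℂ} {A R : ℝ} (h : ∀ j, ‖c j‖ ≤ A * R ^ j) {ρ : ℝ} {z : ℂ}
    (hz : ‖z‖ ≤ ρ) (hA : 0 ≤ A) (hR : 0 ≤ R) (j : ℕ) :
    ‖c j * z ^ j / (Nat.factorial j : ℂ)‖ ≤ A * ((R * ρ) ^ j / (Nat.factorial j : ℝ)) := by
  rw [norm_div, norm_mul, norm_pow, Complex.norm_natCast, mul_pow, ← mul_div_assoc, ← mul_assoc]
  have := h j
  gcongr

theorem GeomBdd.summable {c : ℕ → ℂ} (h : GeomBdd c) (z : ℂ) :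
    Summable (fun j : ℕ => c j * z ^ j / (Nat.factorial j : ℂ)) := by
  obtain ⟨A, R, hA, hR, h⟩ := h
  refine Summable.of_norm_bounded ((Real.summable_pow_div_factorial (R * ‖z‖)).mul_left A)
    (fun j => expSer_term_le h le_rfl hA hR j)

theorem expSer_hasDerivAt {c : ℕ → ℂ} (h : GeomBdd c) (z : ℂ) :
    HasDerivAt (expSer c) (expSer (fun j => c (j+1)) z) z := by
  obtain ⟨A, R, hA, hR, hb⟩ := h.shift
  set ρ := ‖z‖ + 1
  let g' : ℕ → ℂ → ℂ := fun j w => c j * ((j:ℂ) * w ^ (j-1)) / (Nat.factorial j : ℂ)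
  have hg's : ∀ j w, g' (j+1) w = c (j+1) * w ^ j / (Nat.factorial j : ℂ) := by
    intro j w
    simp only [g', Nat.factorial_succ, Nat.add_sub_cancel]
    have : ((j:ℂ)+1) ≠ 0 := by exact_mod_cast Nat.succ_ne_zero j
    have h2 : (Nat.factorial j : ℂ) ≠ 0 := by exact_mod_cast Nat.factorial_ne_zero j
    push_cast
    field_simp
  have hg'0 : ∀ w, g' 0 w = 0 := by intro w; simp [g']
  let u : ℕ → ℝ := fun j => Nat.casesOn j 0 (fun k => A * ((R * ρ) ^ k / (Nat.factorial k : ℝ)))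
  have hu : Summable u := by
    rw [← summable_nat_add_iff 1]
    exact (Real.summable_pow_div_factorial (R * ρ)).mul_left A
  have key := hasDerivAt_tsum_of_isPreconnected (g := fun j w => c j * w ^ j / (Nat.factorial j : ℂ))
    (g' := g') (t := Metric.ball 0 ρ) (y₀ := z) (y := z) hu Metric.isOpen_ball
    (convex_ball _ _).isPreconnected ?_ ?_ ?_ (h.summable z) ?_
  · have : expSer (fun j => c (j+1)) z = ∑' n, g' n z := by
      rw [Summable.tsum_eq_zero_add]
      · rw [hg'0, zero_add]
        simp only [hg's]; rfl
      · rw [← summable_nat_add_iff 1]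
        simp only [hg's]
        exact h.shift.summable z
    rw [this]; exact key
  · intro j w _
    exact ((hasDerivAt_pow j w).const_mul (c j)).div_const _
  · intro j w hw
    have hw : ‖w‖ ≤ ρ := by simpa using (Metric.mem_ball.1 hw).le
    cases j with
    | zero => simp [hg'0, u]
    | succ k =>
      rw [hg's]
      exact expSer_term_le hb hw hA hR k
  · simp [ρ]
  · simp [ρ]

theorem expSer_nat_mul {c : ℕ → ℂ} (h : GeomBdd c) (z : ℂ) :
    HasSum (fun j : ℕ => ((j:ℂ) * c j) * z ^ j / (Nat.factorial j : ℂ))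
      (z * expSer (fun j => c (j+1)) z) := by
  rw [← hasSum_nat_add_iff' 1]
  have := ((h.shift.summable z).hasSum).mul_left z
  simp only [Finset.range_one, Finset.sum_singleton, Nat.cast_zero, zero_mul, zero_div, sub_zero]
  refine Eq.mp (congrArg (fun q => HasSum q _) (funext fun j => ?_)) this
  have : ((j:ℂ)+1) ≠ 0 := by exact_mod_cast Nat.succ_ne_zero j
  have h2 : (Nat.factorial j : ℂ) ≠ 0 := by exact_mod_cast Nat.factorial_ne_zero j
  rw [Nat.factorial_succ]
  push_cast
  field_simp
  ring

/-- Volterra step: derivative. -/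
noncomputable def nxtD (κ : ℝ) (f : ℝ → ℝ) (x : ℝ) : ℝ :=
  -(Real.exp x * x ^ (-(2*κ))) * ∫ t in Set.Ioi x, Real.exp (-t) * t ^ (2*κ) * (f t / t^2)

/-- Volterra step: function. -/
noncomputable def nxtF (κ : ℝ) (f : ℝ → ℝ) (x : ℝ) : ℝ :=
  -∫ t in Set.Ioi x, nxtD κ f t

/-- The Volterra iterates. -/
noncomputable def fs (κ : ℝ) : ℕ → ℝ → ℝ
  | 0 => fun _ => 1
  | n+1 => nxtF κ (fs κ n)

/-- Their derivatives. -/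
noncomputable def ds (κ : ℝ) : ℕ → ℝ → ℝ
  | 0 => fun _ => 0
  | n+1 => nxtD κ (fs κ n)

theorem tail_hasDerivAt {x1 : ℝ} {h : ℝ → ℝ} (hc : ContinuousOn h (Set.Ioi x1))
    (hi : ∀ s, x1 < s → MeasureTheory.IntegrableOn h (Set.Ioi s)) {x : ℝ} (hx : x1 < x) :
    HasDerivAt (fun y => ∫ t in Set.Ioi y, h t) (-(h x)) x := by
  set a := (x1 + x) / 2
  have ha : x1 < a := by simp only [a]; linarith
  have hax : a < x := by simp only [a]; linarith
  have hev : (fun y => ∫ t in Set.Ioi y, h t) =ᶠ[nhds x]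
      (fun y => (∫ t in Set.Ioi a, h t) - ∫ t in a..y, h t) := by
    filter_upwards [Ioi_mem_nhds hax] with y hy
    rw [← intervalIntegral.integral_Ioi_sub_Ioi (hi a ha) (le_of_lt hy)]
    ring
  refine HasDerivAt.congr_of_eventuallyEq ?_ hev
  refine HasDerivAt.const_sub _ ?_
  refine intervalIntegral.integral_hasDerivAt_right ?_ ?_ ?_
  · apply ContinuousOn.intervalIntegrable
    apply hc.mono
    rw [Set.uIcc_of_le hax.le]
    intro t ht
    exact lt_of_lt_of_le ha ht.1
  · exact hc.stronglyMeasurableAtFilter isOpen_Ioi x hx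
  · exact hc.continuousAt (Ioi_mem_nhds hx)

theorem weight_bound (κ : ℝ) {x1 : ℝ} (h1 : 0 < x1) : ∃ C : ℝ, 0 < C ∧ ∀ s t, x1 ≤ s → s ≤ t →
    Real.exp (-t) * t ^ (2*κ) ≤ C * (Real.exp (-s) * s ^ (2*κ)) * Real.exp (-(1/2) * (t - s)) := by
  obtain ⟨m, hm⟩ := exists_nat_ge (2*κ)
  -- (1+u/x1)^m ≤ C exp(u/2)
  have hlim : ∃ C : ℝ, 0 < C ∧ ∀ u, 0 ≤ u → (1 + u / x1)^m ≤ C * Real.exp (u/2) := by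
    -- 1 + u/x1 ≤ c exp(u/(2(m+1)))
    set c := 1 + 2 * ((m:ℝ)+1) / x1
    have hcpos : 0 < c := by positivity
    refine ⟨c ^ m, by positivity, fun u hu => ?_⟩
    have e1 : 1 + u / x1 ≤ c * Real.exp (u / (2*((m:ℝ)+1))) := by
      have h2 := Real.add_one_le_exp (u / (2*((m:ℝ)+1)))
      have h3 : u / (2*((m:ℝ)+1)) ≥ 0 := by positivity
      calc 1 + u / x1 ≤ 1 + u / x1 + 2 * ((m:ℝ)+1) / x1 + u / (2*((m:ℝ)+1)) := by
            have : 0 ≤ 2 * ((m:ℝ)+1) / x1 := by positivity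
            linarith
        _ = c * (u / (2*((m:ℝ)+1)) + 1) := by simp only [c]; field_simp; ring
        _ ≤ _ := by gcongr
    calc (1 + u / x1)^m ≤ (c * Real.exp (u / (2*((m:ℝ)+1))))^m := by
          gcongr
      _ = c ^ m * Real.exp (m * (u / (2*((m:ℝ)+1)))) := by rw [mul_pow, ← Real.exp_nat_mul]
      _ ≤ _ := by
          gcongr
          rw [mul_div_assoc', div_le_div_iff₀ (by positivity) (by positivity)]
          nlinarith
  obtain ⟨C, hC, hCb⟩ := hlim
  refine ⟨C, hC, fun s t hs hst => ?_⟩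
  have hs0 : 0 < s := h1.trans_le hs
  have ht0 : 0 < t := hs0.trans_le hst
  have h2 : (t/s) ^ (2*κ) ≤ C * Real.exp ((t-s)/2) := by
    calc (t/s) ^ (2*κ) ≤ (t/s) ^ (m:ℝ) :=
          Real.rpow_le_rpow_of_exponent_le ((one_le_div hs0).2 hst) hm
      _ = (t/s)^m := Real.rpow_natCast _ _
      _ ≤ (1 + (t-s)/x1)^m := by
          gcongr
          have : t / s = 1 + (t-s)/s := by field_simp; ring
          rw [this]
          have : 0 ≤ t - s := by linarith
          gcongr
      _ ≤ _ := hCb _ (by linarith)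
  have h3 : t ^ (2*κ) = (t/s) ^ (2*κ) * s ^ (2*κ) := by
    rw [← Real.mul_rpow (by positivity) hs0.le]; congr 1; field_simp
  have h4 : Real.exp (-t) = Real.exp (-s) * Real.exp (-(1/2)*(t-s)) * Real.exp (-((t-s)/2)) := by
    rw [← Real.exp_add, ← Real.exp_add]; congr 1; ring
  rw [h3]
  calc Real.exp (-t) * ((t/s) ^ (2*κ) * s ^ (2*κ)) ≤ Real.exp (-t) * ((C * Real.exp ((t-s)/2)) * s ^ (2*κ)) := by
        gcongr
    _ = _ := by
        rw [h4, Real.exp_neg ((t-s)/2)]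
        field_simp

theorem exp_tail (s : ℝ) : MeasureTheory.IntegrableOn (fun t => Real.exp (-(1/2) * (t - s))) (Set.Ioi s) ∧
    ∫ t in Set.Ioi s, Real.exp (-(1/2) * (t - s)) = 2 := by
  have h : ∀ t, Real.exp (-(1/2) * (t - s)) = Real.exp (s/2) * Real.exp (-(1/2) * t) := by
    intro t; rw [← Real.exp_add]; congr 1; ring
  simp only [h]
  constructor
  · exact (integrableOn_exp_mul_Ioi (by norm_num) s).const_mul _
  · rw [MeasureTheory.integral_const_mul, integral_exp_mul_Ioi (by norm_num)]
    have : Real.exp (s/2) * Real.exp (-(1/2)*s) = 1 := by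
      rw [← Real.exp_add]; ring_nf; simp
    linear_combination 2 * this

theorem pow_tail (n : ℕ) {s : ℝ} (hs : 0 < s) :
    MeasureTheory.IntegrableOn (fun t : ℝ => (1/t)^(n+2)) (Set.Ioi s) ∧
    ∫ t in Set.Ioi s, (1/t)^(n+2) = (1/s)^(n+1) / (n+1) := by
  have he : ∀ t : ℝ, 0 < t → (1/t)^(n+2) = t ^ (-((n:ℝ)+2)) := by
    intro t ht
    rw [Real.rpow_neg ht.le, one_div, inv_pow]
    norm_cast
  have hlt : (-((n:ℝ)+2)) < -1 := by
    have : (0:ℝ) ≤ n := by positivity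
    linarith
  constructor
  · refine (integrableOn_Ioi_rpow_of_lt hlt hs).congr_fun (fun t ht => ?_) measurableSet_Ioi
    exact (he t (hs.trans ht)).symm
  · rw [MeasureTheory.setIntegral_congr_fun measurableSet_Ioi (fun t ht => he t (hs.trans ht)),
      integral_Ioi_rpow_of_lt hlt hs]
    have : -((n:ℝ)+2) + 1 = -((n:ℝ)+1) := by ring
    rw [this, Real.rpow_neg hs.le, one_div, inv_pow, neg_div_neg_eq]
    norm_cast

theorem volterra_step (κ : ℝ) {x1 : ℝ} (h1 : 0 < x1) {C : ℝ} (hC : 0 < C)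
    (hw : ∀ s t, x1 ≤ s → s ≤ t →
      Real.exp (-t) * t ^ (2*κ) ≤ C * (Real.exp (-s) * s ^ (2*κ)) * Real.exp (-(1/2) * (t - s)))
    (f : ℝ → ℝ) (hf : ContinuousOn f (Set.Ioi x1)) (n : ℕ) (B : ℝ) (hB : 0 ≤ B)
    (hfB : ∀ t, x1 < t → |f t| ≤ B * (1/t)^n) :
    (∀ x, x1 < x → HasDerivAt (nxtF κ f) (nxtD κ f x) x) ∧
    (∀ x, x1 < x → HasDerivAt (nxtD κ f) ((1 - 2*κ/x) * nxtD κ f x + f x / x^2) x) ∧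
    (∀ x, x1 < x → |nxtD κ f x| ≤ 2 * C * B * (1/x)^(n+2)) ∧
    (∀ x, x1 < x → |nxtF κ f x| ≤ 2 * C * B / (n+1) * (1/x)^(n+1)) := by
  set h : ℝ → ℝ := fun t => Real.exp (-t) * t ^ (2*κ) * (f t / t^2) with hh
  have hhc : ContinuousOn h (Set.Ioi x1) := by
    have hne : ∀ t ∈ Set.Ioi x1, t ≠ 0 := fun t ht => (h1.trans ht).ne'
    refine ((Real.continuous_exp.comp continuous_neg).continuousOn.mul ?_).mul (hf.div (by fun_prop) ?_)
    · exact continuousOn_id.rpow_const (fun t ht => Or.inl (hne t ht))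
    · intro t ht; exact pow_ne_zero _ (hne t ht)
  have hhb : ∀ s t, x1 < s → s < t →
      ‖h t‖ ≤ (C * (Real.exp (-s) * s ^ (2*κ)) * (B * (1/s)^(n+2))) * Real.exp (-(1/2) * (t - s)) := by
    intro s t hs hst
    have hs0 : 0 < s := h1.trans hs
    have ht0 : 0 < t := hs0.trans hst
    have e1 : |f t / t^2| ≤ B * (1/s)^(n+2) := by
      rw [abs_div, abs_of_pos (by positivity : 0 < t^2)]
      calc |f t| / t^2 ≤ B * (1/t)^n / t^2 := by gcongr; exact hfB t (hs.trans hst)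
        _ = B * (1/t)^(n+2) := by ring
        _ ≤ _ := by gcongr
    have e2 := hw s t hs.le hst.le
    have e3 : 0 ≤ Real.exp (-t) * t ^ (2*κ) := by positivity
    rw [hh, Real.norm_eq_abs, abs_mul, abs_of_nonneg e3]
    calc _ ≤ (C * (Real.exp (-s) * s ^ (2*κ)) * Real.exp (-(1/2) * (t - s))) * (B * (1/s)^(n+2)) := by
            gcongr
      _ = _ := by ring
  have hhi : ∀ s, x1 < s → MeasureTheory.IntegrableOn h (Set.Ioi s) := by
    intro s hs
    refine MeasureTheory.Integrable.mono' ((exp_tail s).1.const_mul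
      (C * (Real.exp (-s) * s ^ (2*κ)) * (B * (1/s)^(n+2)))) ?_ ?_
    · exact (hhc.mono (Set.Ioi_subset_Ioi hs.le)).aestronglyMeasurable measurableSet_Ioi
    · rw [MeasureTheory.ae_restrict_iff' measurableSet_Ioi]
      exact Filter.Eventually.of_forall (fun t ht => hhb s t hs ht)
  have hDb : ∀ x, x1 < x → |nxtD κ f x| ≤ 2 * C * B * (1/x)^(n+2) := by
    intro x hx
    have hx0 : 0 < x := h1.trans hx
    have hI : ‖∫ t in Set.Ioi x, h t‖ ≤ (C * (Real.exp (-x) * x ^ (2*κ)) * (B * (1/x)^(n+2))) * 2 := by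
      refine (MeasureTheory.norm_integral_le_of_norm_le ((exp_tail x).1.const_mul
        (C * (Real.exp (-x) * x ^ (2*κ)) * (B * (1/x)^(n+2)))) ?_).trans
        (le_of_eq (by rw [MeasureTheory.integral_const_mul, (exp_tail x).2]))
      rw [MeasureTheory.ae_restrict_iff' measurableSet_Ioi]
      exact Filter.Eventually.of_forall (fun t ht => hhb x t hx ht)
    rw [nxtD, abs_mul, abs_neg, abs_of_pos (by positivity)]
    have hr : Real.exp x * x ^ (-(2*κ)) * (Real.exp (-x) * x ^ (2*κ)) = 1 := by
      rw [Real.rpow_neg hx0.le, Real.exp_neg]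
      have := Real.rpow_pos_of_pos hx0 (2*κ)
      field_simp
    calc _ ≤ Real.exp x * x ^ (-(2*κ)) * ((C * (Real.exp (-x) * x ^ (2*κ)) * (B * (1/x)^(n+2))) * 2) := by
          gcongr; exact hI
      _ = _ := by linear_combination (2 * C * B * (1/x)^(n+2)) * hr
  have hDd : ∀ x, x1 < x → HasDerivAt (nxtD κ f) ((1 - 2*κ/x) * nxtD κ f x + f x / x^2) x := by
    intro x hx
    have hx0 : 0 < x := h1.trans hx
    have d1 := tail_hasDerivAt hhc hhi hx
    have d2 := (((Real.hasDerivAt_exp x).mul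
      (Real.hasDerivAt_rpow_const (x := x) (p := -(2*κ)) (Or.inl hx0.ne'))).neg).mul d1
    refine d2.congr_deriv ?_
    have hr : x ^ (-(2*κ)) * x ^ (2*κ) = 1 := by
      rw [← Real.rpow_add hx0]; simp
    have hr2 : Real.exp x * Real.exp (-x) = 1 := by rw [← Real.exp_add]; simp
    have hr3 : x ^ (-(2*κ) - 1) = x ^ (-(2*κ)) / x := by rw [Real.rpow_sub hx0, Real.rpow_one]
    rw [hr3]
    simp only [nxtD, hh, Pi.mul_apply, Pi.neg_apply]
    linear_combination (f x / x^2) * (x ^ (-(2*κ)) * x ^ (2*κ)) * hr2 + (f x / x^2) * hr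
  have hDi : ∀ s, x1 < s → MeasureTheory.IntegrableOn (nxtD κ f) (Set.Ioi s) := by
    intro s hs
    refine MeasureTheory.Integrable.mono' ((pow_tail n (h1.trans hs)).1.const_mul (2*C*B)) ?_ ?_
    · refine ContinuousOn.aestronglyMeasurable ?_ measurableSet_Ioi
      intro t ht
      exact (hDd t (hs.trans ht)).continuousAt.continuousWithinAt
    · rw [MeasureTheory.ae_restrict_iff' measurableSet_Ioi]
      exact Filter.Eventually.of_forall (fun t ht => hDb t (hs.trans ht))
  refine ⟨fun x hx => ?_, hDd, hDb, fun x hx => ?_⟩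
  · have := (tail_hasDerivAt (fun t ht => (hDd t ht).continuousAt.continuousWithinAt) hDi hx).neg
    rw [neg_neg] at this
    exact this
  · have hI : ‖∫ t in Set.Ioi x, nxtD κ f t‖ ≤ (2*C*B) * ((1/x)^(n+1) / (n+1)) := by
      rw [← (pow_tail n (h1.trans hx)).2, ← MeasureTheory.integral_const_mul]
      refine MeasureTheory.norm_integral_le_of_norm_le ((pow_tail n (h1.trans hx)).1.const_mul _) ?_
      rw [MeasureTheory.ae_restrict_iff' measurableSet_Ioi]
      exact Filter.Eventually.of_forall (fun t ht => hDb t (hx.trans ht))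
    rw [nxtF, abs_neg]
    refine hI.trans (le_of_eq ?_)
    ring

theorem volterra_seq (κ : ℝ) {x1 : ℝ} (h1 : 0 < x1) : ∃ K : ℝ, 0 < K ∧
    (∀ n x, x1 < x → HasDerivAt (fs κ n) (ds κ n x) x) ∧
    (∀ x, x1 < x → HasDerivAt (ds κ 0) ((1 - 2*κ/x) * ds κ 0 x) x) ∧
    (∀ n x, x1 < x → HasDerivAt (ds κ (n+1)) ((1 - 2*κ/x) * ds κ (n+1) x + fs κ n x / x^2) x) ∧
    (∀ n x, x1 < x → |fs κ n x| ≤ K^n / (Nat.factorial n : ℝ) * (1/x)^n) ∧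
    (∀ n x, x1 < x → |ds κ (n+1) x| ≤ K^(n+1) / (Nat.factorial n : ℝ) * (1/x)^(n+2)) := by
  obtain ⟨C, hC, hw⟩ := weight_bound κ h1
  have main : ∀ n, ((∀ x, x1 < x → HasDerivAt (fs κ n) (ds κ n x) x) ∧
      (∀ x, x1 < x → |fs κ n x| ≤ (2*C)^n / (Nat.factorial n : ℝ) * (1/x)^n)) := by
    intro n
    induction n with
    | zero => 
      refine ⟨fun x _ => ?_, fun x _ => ?_⟩
      · exact hasDerivAt_const x (1:ℝ)
      · simp [fs]
    | succ n ih =>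
      obtain ⟨s1, s2, s3, s4⟩ := volterra_step κ h1 hC hw (fs κ n)
        (fun t ht => (ih.1 t ht).continuousAt.continuousWithinAt) n _ (by positivity) ih.2
      refine ⟨s1, fun x hx => (s4 x hx).trans (le_of_eq ?_)⟩
      rw [Nat.factorial_succ]; push_cast
      field_simp
      ring
  have step := fun n => volterra_step κ h1 hC hw (fs κ n)
        (fun t ht => ((main n).1 t ht).continuousAt.continuousWithinAt) n _ (by positivity) (main n).2
  refine ⟨2*C, by positivity, fun n => (main n).1, fun x _ => ?_, fun n => (step n).2.1,
    fun n => (main n).2, fun n x hx => ((step n).2.2.1 x hx).trans (le_of_eq ?_)⟩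
  · simpa [ds] using hasDerivAt_const x (0:ℝ)
  · ring


/-- Combination of the Volterra iterates. -/
noncomputable def sfun (κ : ℝ) (α : ℕ → ℂ) (x : ℝ) : ℂ := ∑' n, α n * (fs κ n x : ℂ)

/-- Its derivative. -/
noncomputable def sder (κ : ℝ) (α : ℕ → ℂ) (x : ℝ) : ℂ := ∑' n, α n * (ds κ n x : ℂ)

set_option maxHeartbeats 1000000 in
theorem sfun_all (κ : ℝ) {x1 : ℝ} (h1 : 0 < x1) {α : ℕ → ℂ} (hα : GeomBdd α) :
    (∀ x, x1 < x → Summable (fun n => α n * (fs κ n x : ℂ))) ∧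
    (∀ x, x1 < x → Summable (fun n => α n * (ds κ n x : ℂ))) ∧
    (∀ x, x1 < x → HasDerivAt (sfun κ α) (sder κ α x) x) ∧
    (∀ x, x1 < x → HasDerivAt (sder κ α)
      ((1 - 2*κ/x) * sder κ α x + sfun κ (fun n => α (n+1)) x / x^2) x) ∧
    Filter.Tendsto (sfun κ α) Filter.atTop (nhds (α 0)) ∧
    Filter.Tendsto (sder κ α) Filter.atTop (nhds 0) := by
  obtain ⟨K, hK, hf, hd0, hd, hfb, hdb⟩ := volterra_seq κ h1
  obtain ⟨A, R, hA, hR, hb⟩ := hα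
  have hdiv : ∀ x, x1 < x → 1/x ≤ 1/x1 := fun x hx => by gcongr
  set θ := R * K / x1 with hθ
  let e : ℕ → ℝ := fun n => θ ^ n / (Nat.factorial n : ℝ)
  have he : Summable e := Real.summable_pow_div_factorial θ
  let uf : ℕ → ℝ := fun n => A * e n
  let ud : ℕ → ℝ := fun n => Nat.casesOn n 0 (fun k => A * R * K / x1^2 * e k)
  set c : ℝ := 1 + 2*|κ|/x1
  let udd : ℕ → ℝ := fun n => Nat.casesOn n 0 (fun k => c * (A * R * K / x1^2 * e k) + A * R / x1^2 * e k)
  have huf : Summable uf := he.mul_left A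
  have hud : Summable ud := by
    rw [← summable_nat_add_iff 1]; exact he.mul_left _
  have hudd : Summable udd := by
    rw [← summable_nat_add_iff 1]; exact ((he.mul_left _).mul_left _).add (he.mul_left _)
  have Bf : ∀ n x, x1 < x → ‖α n * (fs κ n x : ℂ)‖ ≤ uf n := by
    intro n x hx
    have hx0 := h1.trans hx
    rw [norm_mul, Complex.norm_real, Real.norm_eq_abs]
    calc _ ≤ (A * R^n) * (K^n / (Nat.factorial n : ℝ) * (1/x1)^n) := by
          have a1 := hb n
          have a2 := hfb n x hx
          have a3 := hdiv x hx
          have a4 : K^n / (Nat.factorial n : ℝ) * (1/x)^n ≤ K^n / (Nat.factorial n : ℝ) * (1/x1)^n := by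
            gcongr
          exact mul_le_mul a1 (a2.trans a4) (abs_nonneg _) (by positivity)
      _ = uf n := by simp only [uf, e, hθ, div_pow, mul_pow]; ring
  have Bd : ∀ n x, x1 < x → ‖α n * (ds κ n x : ℂ)‖ ≤ ud n := by
    intro n x hx
    cases n with
    | zero => simp [ds, ud]
    | succ n =>
      have hx0 := h1.trans hx
      rw [norm_mul, Complex.norm_real, Real.norm_eq_abs]
      calc _ ≤ (A * R^(n+1)) * (K^(n+1) / (Nat.factorial n : ℝ) * (1/x1)^(n+2)) := by
            have a1 := hb (n+1)
            have a2 := hdb n x hx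
            have a3 := hdiv x hx
            have a4 : K^(n+1) / (Nat.factorial n : ℝ) * (1/x)^(n+2) ≤
              K^(n+1) / (Nat.factorial n : ℝ) * (1/x1)^(n+2) := by
              gcongr
            exact mul_le_mul a1 (a2.trans a4) (abs_nonneg _) (by positivity)
        _ = ud (n+1) := by simp only [ud, e, hθ, div_pow, mul_pow]; ring
  have Bfs : ∀ n x, x1 < x → ‖α (n+1) * (fs κ n x : ℂ)‖ ≤ A * R * e n := by
    intro n x hx
    have hx0 := h1.trans hx
    rw [norm_mul, Complex.norm_real, Real.norm_eq_abs]
    calc _ ≤ (A * R^(n+1)) * (K^n / (Nat.factorial n : ℝ) * (1/x1)^n) := by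
          have a1 := hb (n+1)
          have a2 := hfb n x hx
          have a3 := hdiv x hx
          have a4 : K^n / (Nat.factorial n : ℝ) * (1/x)^n ≤ K^n / (Nat.factorial n : ℝ) * (1/x1)^n := by
            gcongr
          exact mul_le_mul a1 (a2.trans a4) (abs_nonneg _) (by positivity)
      _ = A * R * e n := by simp only [e, hθ, div_pow, mul_pow]; ring
  have Sf : ∀ x, x1 < x → Summable (fun n => α n * (fs κ n x : ℂ)) := fun x hx =>
    Summable.of_norm_bounded huf (fun n => Bf n x hx)
  have Sd : ∀ x, x1 < x → Summable (fun n => α n * (ds κ n x : ℂ)) := fun x hx =>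
    Summable.of_norm_bounded hud (fun n => Bd n x hx)
  have Sfs : ∀ x, x1 < x → Summable (fun n => α (n+1) * (fs κ n x : ℂ)) := fun x hx =>
    Summable.of_norm_bounded (he.mul_left (A*R)) (fun n => Bfs n x hx)
  let dd : ℕ → ℝ → ℂ := fun n x => Nat.casesOn n 0
    (fun k => α (k+1) * (((1 - 2*κ/x) * ds κ (k+1) x + fs κ k x / x^2 : ℝ) : ℂ))
  have ev1 : ∀ᶠ x : ℝ in Filter.atTop, x1 < x := Filter.eventually_gt_atTop x1
  have hinv : ∀ m : ℕ, ∀ c : ℝ, Filter.Tendsto (fun x : ℝ => c * (1/x)^(m+1)) Filter.atTop (nhds 0) := by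
    intro m c
    have h0 : Filter.Tendsto (fun x : ℝ => 1/x) Filter.atTop (nhds 0) := by
      simpa using tendsto_inv_atTop_zero (𝕜 := ℝ)
    simpa using (h0.pow (m+1)).const_mul c
  refine ⟨Sf, Sd, fun x hx => ?_, fun x hx => ?_, ?_, ?_⟩
  · exact hasDerivAt_tsum_of_isPreconnected (g := fun n x => α n * (fs κ n x : ℂ))
      (g' := fun n x => α n * (ds κ n x : ℂ)) (t := Set.Ioi x1) (y₀ := x) hud isOpen_Ioi
      isPreconnected_Ioi (fun n y hy => ((hf n y hy).ofReal_comp).const_mul _)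
      (fun n y hy => Bd n y hy) hx (Sf x hx) hx
  · have key := hasDerivAt_tsum_of_isPreconnected (g := fun n x => α n * (ds κ n x : ℂ))
      (g' := dd) (t := Set.Ioi x1) (y₀ := x) (y := x) hudd isOpen_Ioi
      isPreconnected_Ioi ?_ ?_ hx (Sd x hx) hx
    · refine HasDerivAt.congr_deriv (f := sder κ α) key ?_
      have hdds : ∀ k, dd (k+1) x = (1 - 2*κ/x) * (α (k+1) * (ds κ (k+1) x : ℂ)) +
          (α (k+1) * (fs κ k x : ℂ)) / x^2 := by
        intro k; simp only [dd]; push_cast; ring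
      have sd1 : Summable (fun k => α (k+1) * (ds κ (k+1) x : ℂ)) :=
        (summable_nat_add_iff 1).2 (Sd x hx)
      have hs1 : Summable (fun k => dd (k+1) x) := by
        simp only [hdds]
        exact (sd1.mul_left _).add ((Sfs x hx).div_const _)
      rw [Summable.tsum_eq_zero_add ((summable_nat_add_iff 1).1 hs1)]
      simp only [hdds]
      rw [Summable.tsum_add (sd1.mul_left _) ((Sfs x hx).div_const _), tsum_mul_left, tsum_div_const]
      rw [sder, Summable.tsum_eq_zero_add (Sd x hx)]
      simp [dd, ds, sfun]
    · intro n y hy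
      cases n with
      | zero => 
        simpa [ds, dd] using hasDerivAt_const y (0:ℂ)
      | succ n => exact ((hd n y hy).ofReal_comp).const_mul _
    · intro n y hy
      have hy0 : 0 < y := h1.trans hy
      cases n with
      | zero => simp [dd, udd]
      | succ n =>
        have e1 : dd (n+1) y = ((1 - 2*κ/y : ℝ):ℂ) * (α (n+1) * (ds κ (n+1) y : ℂ)) +
          (α (n+1) * (fs κ n y : ℂ)) / ((y^2 : ℝ) : ℂ) := by
          simp only [dd]; push_cast; ring
        rw [e1]
        refine (norm_add_le _ _).trans ?_
        rw [norm_mul, norm_div, Complex.norm_real, Complex.norm_real]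
        have b1 := Bd (n+1) y hy
        have b2 := Bfs n y hy
        have b3 : ‖(1 - 2*κ/y : ℝ)‖ ≤ c := by
          have : (2*|κ|)/y ≤ 2*|κ|/x1 := by
            have := le_of_lt hy.out
            gcongr
          calc ‖(1 - 2*κ/y : ℝ)‖ ≤ ‖(1:ℝ)‖ + ‖2*κ/y‖ := norm_sub_le _ _
            _ = 1 + 2*|κ|/y := by
              rw [norm_one, norm_div, norm_mul, Real.norm_eq_abs, Real.norm_eq_abs, Real.norm_eq_abs,
                abs_of_pos hy0]
              norm_num
            _ ≤ _ := by simp only [c]; linarith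
        have b4 : ‖α (n+1) * (fs κ n y : ℂ)‖ / ‖y^2‖ ≤ A * R / x1^2 * e n := by
          rw [Real.norm_eq_abs, abs_of_pos (by positivity : 0 < y^2)]
          calc _ ≤ A * R * e n / x1^2 := by
                have := le_of_lt hy.out
                have he0 : 0 ≤ e n := by simp only [e]; positivity
                gcongr
            _ = _ := by ring
        have b5 : ‖(1 - 2*κ/y : ℝ)‖ * ‖α (n+1) * (ds κ (n+1) y : ℂ)‖ ≤ c * ud (n+1) :=
          mul_le_mul b3 b1 (norm_nonneg _) (by positivity)
        exact add_le_add b5 b4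
  · have hlim : α 0 = ∑' n, (if n = 0 then α 0 else 0) := by simp
    rw [hlim]
    refine tendsto_tsum_of_dominated_convergence huf (fun n => ?_) ?_
    · cases n with
      | zero => simp [fs]
      | succ n =>
        simp only [Nat.succ_ne_zero, if_false]
        have : Filter.Tendsto (fs κ (n+1)) Filter.atTop (nhds 0) := by
          refine squeeze_zero_norm' ?_ (hinv n (K^(n+1) / (Nat.factorial (n+1) : ℝ)))
          filter_upwards [ev1] with x hx using hfb (n+1) x hx
        have h2 := (Complex.continuous_ofReal.tendsto 0).comp this
        simpa using h2.const_mul (α (n+1))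
    · filter_upwards [ev1] with x hx n using Bf n x hx
  · have hlim : (0:ℂ) = ∑' n : ℕ, 0 := by simp
    rw [hlim]
    refine tendsto_tsum_of_dominated_convergence hud (fun n => ?_) ?_
    · cases n with
      | zero => simp [ds]
      | succ n =>
        have : Filter.Tendsto (ds κ (n+1)) Filter.atTop (nhds 0) := by
          refine squeeze_zero_norm' ?_ (hinv (n+1) (K^(n+1) / (Nat.factorial n : ℝ)))
          filter_upwards [ev1] with x hx using hdb n x hx
        have h2 := (Complex.continuous_ofReal.tendsto 0).comp this
        simpa using h2.const_mul (α (n+1))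
    · filter_upwards [ev1] with x hx n using Bd n x hx


theorem mono_trick {H w : ℝ → ℝ} {x0 s : ℝ} (hs : s ≠ 0)
    (hd : ∀ x, x0 ≤ x → HasDerivAt H (s * w x) x) (hw : ∀ x, x0 ≤ x → 0 ≤ w x)
    (h0 : H x0 = 0) (hlim : Filter.Tendsto H Filter.atTop (nhds 0)) :
    ∀ x, x0 < x → w x = 0 := by
  have hd' : ∀ x, x0 ≤ x → HasDerivAt (fun y => s⁻¹ * H y) (w x) x := fun x hx =>
    ((hd x hx).const_mul s⁻¹).congr_deriv (by field_simp)
  have hmono : MonotoneOn (fun y => s⁻¹ * H y) (Set.Ici x0) := by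
    refine monotoneOn_of_deriv_nonneg (convex_Ici x0)
      (fun x hx => (hd' x hx).continuousAt.continuousWithinAt) ?_ ?_
    · intro x hx
      exact (hd' x (interior_subset hx)).differentiableAt.differentiableWithinAt
    · intro x hx
      rw [(hd' x (interior_subset hx)).deriv]
      exact hw x (interior_subset hx)
  have hlim' : Filter.Tendsto (fun y => s⁻¹ * H y) Filter.atTop (nhds 0) := by
    simpa using hlim.const_mul s⁻¹
  have hz : ∀ x, x0 ≤ x → s⁻¹ * H x = 0 := by
    intro x hx
    apply le_antisymm
    · refine ge_of_tendsto hlim' ?_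
      filter_upwards [Filter.eventually_ge_atTop x] with y hy
      exact hmono hx (hx.trans hy) hy
    · have := hmono (Set.mem_Ici.2 le_rfl) hx hx
      simpa [h0] using this
  intro x hx
  have h1 : (fun y => s⁻¹ * H y) =ᶠ[nhds x] fun _ => 0 := by
    filter_upwards [Ioi_mem_nhds hx] with y hy using hz y (le_of_lt hy)
  have h2 := (hd' x hx.le).congr_of_eventuallyEq h1.symm
  exact h2.unique (hasDerivAt_const x (0:ℝ))

theorem geom_pow (l : ℂ) : GeomBdd (fun n => l ^ n) :=
  ⟨1, ‖l‖, by norm_num, norm_nonneg _, fun j => by simp⟩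

theorem geom_dpow (l : ℂ) : GeomBdd (fun n => (n:ℂ) * l ^ (n-1)) := by
  refine ⟨1, 2 * (‖l‖ + 1), by norm_num, by positivity, fun j => ?_⟩
  rw [norm_mul, norm_pow, Complex.norm_natCast, one_mul, mul_pow]
  have h1 : (j:ℝ) ≤ 2^j := by exact_mod_cast Nat.lt_two_pow_self.le
  have h2 : ‖l‖^(j-1) ≤ (‖l‖+1)^j := by
    calc ‖l‖^(j-1) ≤ (‖l‖+1)^(j-1) := by gcongr; linarith
      _ ≤ _ := by
        apply pow_le_pow_right₀
        · linarith [norm_nonneg l]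
        · omega
  exact mul_le_mul h1 h2 (by positivity) (by positivity)

theorem pw_hasDerivAt (κ : ℝ) {x : ℝ} (hx : 0 < x) :
    HasDerivAt (fun x : ℝ => ((Real.exp (-x) * x ^ (2*κ) : ℝ) : ℂ))
      ((-1 + 2*κ/x) * ((Real.exp (-x) * x ^ (2*κ) : ℝ) : ℂ)) x := by
  have d1 : HasDerivAt (fun x : ℝ => Real.exp (-x)) (-Real.exp (-x)) x := by
    simpa using (hasDerivAt_neg x).exp
  have d2 := (d1.mul (Real.hasDerivAt_rpow_const (x := x) (p := 2*κ) (Or.inl hx.ne'))).ofReal_comp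
  refine d2.congr_deriv ?_
  rw [Real.rpow_sub hx, Real.rpow_one]
  push_cast
  ring

theorem pw_tendsto (κ : ℝ) :
    Filter.Tendsto (fun x : ℝ => ((Real.exp (-x) * x ^ (2*κ) : ℝ) : ℂ)) Filter.atTop (nhds 0) := by
  have h := tendsto_rpow_mul_exp_neg_mul_atTop_nhds_zero (2*κ) 1 one_pos
  have h2 := (Complex.continuous_ofReal.tendsto 0).comp h
  refine Filter.Tendsto.congr (fun x => ?_) (by simpa using h2)
  simp [mul_comm]

theorem zero_real (κ : ℝ) {x0 : ℝ} (h0 : 0 < x0) (l : ℂ) (hz : sfun κ (fun n => l ^ n) x0 = 0) :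
    l.im = 0 := by
  by_contra him
  obtain ⟨-, -, hf, hd, lf, ld⟩ := sfun_all κ (half_pos h0) (geom_pow l)
  have hx1 : x0 / 2 < x0 := by linarith
  set f := sfun κ (fun n => l ^ n)
  set d := sder κ (fun n => l ^ n)
  have hsh : ∀ x, sfun κ (fun n => l ^ (n+1)) x = l * f x := by
    intro x
    simp only [f, sfun, ← tsum_mul_left]
    congr 1; funext n; ring
  simp only [hsh] at hd
  set p : ℝ → ℂ := fun x => ((Real.exp (-x) * x ^ (2*κ) : ℝ) : ℂ)
  have key := mono_trick (H := fun x => (p x * (star (f x) * d x)).im)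
    (w := fun x => Real.exp (-x) * x ^ (2*κ) * ‖f x‖^2 / x^2) (x0 := x0) him ?_ ?_ ?_ ?_
  · have h2 : ∀ x, x0 < x → f x = 0 := by
      intro x hx
      have hx0 : 0 < x := h0.trans hx
      have := key x hx
      have e1 : 0 < Real.exp (-x) * x ^ (2*κ) := by positivity
      have e2 : ‖f x‖^2 = 0 := by
        rw [div_eq_zero_iff] at this
        rcases this with h | h
        · exact (mul_eq_zero.1 h).resolve_left e1.ne'
        · exact absurd h (by positivity)
      simpa using e2
    have h3 : Filter.Tendsto f Filter.atTop (nhds 0) := by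
      refine Filter.Tendsto.congr' ?_ tendsto_const_nhds
      filter_upwards [Filter.eventually_gt_atTop x0] with x hx using (h2 x hx).symm
    have := tendsto_nhds_unique lf h3
    simp at this
  · intro x hx
    have hx1 : x0/2 < x := by linarith
    have hx0 : 0 < x := by linarith
    have D := (pw_hasDerivAt κ hx0).mul ((hf x hx1).star.mul (hd x hx1))
    have D2 := Complex.imCLM.hasFDerivAt.comp_hasDerivAt x D
    refine D2.congr_deriv ?_
    simp only [Complex.imCLM_apply, Pi.mul_apply]
    have e : ((-1 + 2*κ/x) * ((Real.exp (-x) * x ^ (2*κ) : ℝ) : ℂ)) * (star (f x) * d x) +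
        ((Real.exp (-x) * x ^ (2*κ) : ℝ) : ℂ) * (star (d x) * d x + star (f x) *
          ((1 - 2*κ/x) * d x + l * f x / x^2)) =
        ((Real.exp (-x) * x ^ (2*κ) : ℝ) : ℂ) * ((star (d x) * d x) + l * (star (f x) * f x) / x^2) := by
      ring
    refine (congrArg Complex.im e).trans ?_
    have e3 : ∀ z : ℂ, star z * z = ((‖z‖^2 : ℝ) : ℂ) := by
      intro z
      rw [Complex.star_def, Complex.conj_mul']; push_cast; rfl
    have e4 : ((Real.exp (-x) * x ^ (2*κ) : ℝ) : ℂ) * ((star (d x) * d x) + l * (star (f x) * f x) / x^2)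
        = ((Real.exp (-x) * x ^ (2*κ) * ‖d x‖^2 : ℝ) : ℂ) +
          l * ((Real.exp (-x) * x ^ (2*κ) * ‖f x‖^2 / x^2 : ℝ) : ℂ) := by
      rw [e3, e3]; push_cast; ring
    rw [e4, Complex.add_im, Complex.ofReal_im, Complex.im_mul_ofReal, zero_add]
  · intro x hx
    have hx0 : 0 < x := h0.trans_le hx
    positivity
  · simp [hz]
  · have h1 := (pw_tendsto κ).mul ((lf.star).mul ld)
    have h2 := (Complex.continuous_im.tendsto _).comp h1
    rw [zero_mul, Complex.zero_im] at h2
    exact h2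

theorem zero_simple (κ : ℝ) {x0 : ℝ} (h0 : 0 < x0) (l : ℂ) (hz : sfun κ (fun n => l ^ n) x0 = 0) :
    sfun κ (fun n => (n:ℂ) * l ^ (n-1)) x0 ≠ 0 := by
  intro hg0
  have him := zero_real κ h0 l hz
  obtain ⟨sf, -, hf, hd, lf, ld⟩ := sfun_all κ (half_pos h0) (geom_pow l)
  obtain ⟨sg, -, hg, he, lg, le⟩ := sfun_all κ (half_pos h0) (geom_dpow l)
  have hx1 : x0 / 2 < x0 := by linarith
  have hsh : ∀ x, sfun κ (fun n => l ^ (n+1)) x = l * sfun κ (fun n => l ^ n) x := by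
    intro x
    simp only [sfun, ← tsum_mul_left]
    congr 1; funext n; ring
  have hsh2 : ∀ x, x0/2 < x → sfun κ (fun n => ((n+1:ℕ):ℂ) * l ^ (n+1-1)) x =
      l * sfun κ (fun n => (n:ℂ) * l ^ (n-1)) x + sfun κ (fun n => l ^ n) x := by
    intro x hx
    simp only [sfun, ← tsum_mul_left]
    rw [← Summable.tsum_add ((sg x hx).mul_left l) (sf x hx)]
    congr 1; funext n
    cases n with
    | zero => simp
    | succ n => simp only [Nat.add_sub_cancel]; push_cast; ring
  have him2 : ∀ x, x0/2 < x → (sfun κ (fun n => l ^ n) x).im = 0 := by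
    intro x hx
    have hl : l = ((l.re : ℝ) : ℂ) := by
      apply Complex.ext <;> simp [him]
    have : sfun κ (fun n => l ^ n) x = ((∑' n, l.re ^ n * fs κ n x : ℝ) : ℂ) := by
      rw [sfun, Complex.ofReal_tsum, hl]
      push_cast
      simp
    rw [this, Complex.ofReal_im]
  simp only [hsh] at hd
  set f := sfun κ (fun n => l ^ n)
  set d := sder κ (fun n => l ^ n)
  set g := sfun κ (fun n => (n:ℂ) * l ^ (n-1))
  set e := sder κ (fun n => (n:ℂ) * l ^ (n-1))
  set p : ℝ → ℂ := fun x => ((Real.exp (-x) * x ^ (2*κ) : ℝ) : ℂ)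
  have key := mono_trick (H := fun x => (p x * (e x * f x - g x * d x)).re)
    (w := fun x => Real.exp (-x) * x ^ (2*κ) * (f x).re^2 / x^2) (x0 := x0) one_ne_zero ?_ ?_ ?_ ?_
  · have h2 : ∀ x, x0 < x → f x = 0 := by
      intro x hx
      have hx0 : 0 < x := h0.trans hx
      have := key x hx
      have e1 : 0 < Real.exp (-x) * x ^ (2*κ) := by positivity
      have e2 : (f x).re^2 = 0 := by
        rw [div_eq_zero_iff] at this
        rcases this with h | h
        · exact (mul_eq_zero.1 h).resolve_left e1.ne'
        · exact absurd h (by positivity)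
      apply Complex.ext
      · simpa using e2
      · simpa using him2 x (by linarith)
    have h3 : Filter.Tendsto f Filter.atTop (nhds 0) := by
      refine Filter.Tendsto.congr' ?_ tendsto_const_nhds
      filter_upwards [Filter.eventually_gt_atTop x0] with x hx using (h2 x hx).symm
    have := tendsto_nhds_unique lf h3
    simp at this
  · intro x hx
    have hx1 : x0/2 < x := by linarith
    have hx0 : 0 < x := by linarith
    have D := (pw_hasDerivAt κ hx0).mul (((he x hx1).mul (hf x hx1)).sub ((hg x hx1).mul (hd x hx1)))
    have D2 := Complex.reCLM.hasFDerivAt.comp_hasDerivAt x D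
    refine D2.congr_deriv ?_
    simp only [Complex.reCLM_apply, Pi.mul_apply]
    rw [hsh2 x hx1]
    have hfr : f x = (((f x).re : ℝ) : ℂ) := by
      apply Complex.ext <;> simp [him2 x hx1]
    have e1 : ((-1 + 2*κ/x) * ((Real.exp (-x) * x ^ (2*κ) : ℝ) : ℂ)) * (e x * f x - g x * d x) +
        ((Real.exp (-x) * x ^ (2*κ) : ℝ) : ℂ) * (((1 - 2*κ/x) * e x + (l * g x + f x) / x^2) * f x + e x * d x -
          (e x * d x + g x * ((1 - 2*κ/x) * d x + l * f x / x^2))) =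
        ((Real.exp (-x) * x ^ (2*κ) : ℝ) : ℂ) * (f x * f x) / x^2 := by
      ring
    refine (congrArg Complex.re e1).trans ?_
    have e4 : ((Real.exp (-x) * x ^ (2*κ) : ℝ) : ℂ) * (f x * f x) / x^2
        = ((Real.exp (-x) * x ^ (2*κ) * (f x).re^2 / x^2 : ℝ) : ℂ) := by
      rw [hfr]; simp only [Complex.ofReal_re]; push_cast; ring
    rw [e4, Complex.ofReal_re, one_mul]
  · intro x hx
    have hx0 : 0 < x := h0.trans_le hx
    positivity
  · simp [hz, hg0]
  · have h1 := (pw_tendsto κ).mul ((le.mul lf).sub (lg.mul ld))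
    have h2 := (Complex.continuous_re.tendsto _).comp h1
    rw [zero_mul, Complex.zero_re] at h2
    exact h2


theorem borel_growth {c : ℕ → ℂ} {s C : ℂ}
    (h : Filter.Tendsto (fun j : ℕ => c j / (j:ℂ)^s) Filter.atTop (nhds C)) {η : ℝ} (hη : 0 < η) :
    ∃ K : ℝ, 0 ≤ K ∧ ∀ j, ‖c j‖ ≤ K * Real.exp (η * j) := by
  have h1 : Filter.Tendsto (fun j : ℕ => ‖c j‖ * Real.exp (-η * j)) Filter.atTop (nhds 0) := by
    have h2 := ((tendsto_rpow_mul_exp_neg_mul_atTop_nhds_zero s.re η hη).comp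
      (tendsto_natCast_atTop_atTop (R := ℝ)))
    have h3 := h.norm.mul h2
    rw [mul_zero] at h3
    refine h3.congr' ?_
    filter_upwards [Filter.eventually_gt_atTop 0] with j hj
    have hj0 : (0:ℝ) < j := by exact_mod_cast hj
    have e : ‖(j:ℂ)^s‖ = (j:ℝ)^s.re := by
      rw [← Complex.norm_cpow_eq_rpow_re_of_pos hj0]; simp
    have e2 := Real.rpow_pos_of_pos hj0 s.re
    simp only [Function.comp, norm_div, e]
    field_simp
  obtain ⟨K, hK⟩ := h1.bddAbove_range
  have hK' : ∀ j : ℕ, ‖c j‖ * Real.exp (-η * j) ≤ K := fun j => hK ⟨j, rfl⟩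
  refine ⟨K, le_trans (by positivity) (hK' 0), fun j => ?_⟩
  have e : Real.exp (-η * j) * Real.exp (η * j) = 1 := by rw [← Real.exp_add]; simp
  calc ‖c j‖ = ‖c j‖ * Real.exp (-η * j) * Real.exp (η * j) := by rw [mul_assoc, e, mul_one]
    _ ≤ _ := by gcongr; exact hK' j

theorem borel_geom {c : ℕ → ℂ} {s C : ℂ}
    (h : Filter.Tendsto (fun j : ℕ => c j / (j:ℂ)^s) Filter.atTop (nhds C)) : GeomBdd c := by
  obtain ⟨K, hK, hb⟩ := borel_growth h one_pos
  refine ⟨K, Real.exp 1, hK, (Real.exp_pos _).le, fun j => ?_⟩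
  have := hb j
  rwa [one_mul, ← mul_one (j:ℝ), Real.exp_nat_mul] at this

theorem chern_neg {r : ℝ} (hr : 0 < r) (h1 : r ≠ 1) : r - 1 - r * Real.log r < 0 := by
  have h := Real.log_lt_sub_one_of_pos (inv_pos.2 hr) (by simpa using h1)
  rw [Real.log_inv] at h
  have h2 := mul_lt_mul_of_pos_left h hr
  have : r * r⁻¹ = 1 := mul_inv_cancel₀ hr.ne'
  nlinarith

theorem poisson_sum (x q : ℝ) :
    HasSum (fun j : ℕ => Real.exp (-x) * x ^ j / (Nat.factorial j : ℝ) * q ^ j)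
      (Real.exp (-x) * Real.exp (x * q)) := by
  have h := NormedSpace.expSeries_div_hasSum_exp (𝔸 := ℝ) (x * q)
  rw [← Real.exp_eq_exp_ℝ] at h
  have h2 := h.mul_left (Real.exp (-x))
  refine Eq.mp (congrArg (fun q => HasSum q _) (funext fun j => ?_)) h2
  rw [mul_pow]; ring

theorem poisson_csum (x : ℝ) :
    HasSum (fun j : ℕ => ((Real.exp (-x) * x ^ j / (Nat.factorial j : ℝ) : ℝ) : ℂ)) 1 := by
  have h := poisson_sum x 1
  rw [mul_one, ← Real.exp_add] at h
  simp only [neg_add_cancel, Real.exp_zero, one_pow, mul_one] at h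
  have h2 := Complex.hasSum_ofReal.2 h
  rw [Complex.ofReal_one] at h2
  exact h2

theorem borel_asymp {c : ℕ → ℂ} {s C : ℂ}
    (h : Filter.Tendsto (fun j : ℕ => c j / (j:ℂ)^s) Filter.atTop (nhds C)) :
    Filter.Tendsto (fun x : ℝ => (Real.exp (-x) : ℂ) * (x:ℂ)^(-s) * expSer c x) Filter.atTop (nhds C) := by
  rw [Metric.tendsto_nhds]
  intro ε2 hε2
  set ε := ε2 / 2
  have hε : 0 < ε := half_pos hε2
  -- local continuity
  have hcont : Filter.Tendsto (fun w : ℂ × ℝ => w.1 * (w.2:ℂ)^s) (nhds C ×ˢ nhds (1:ℝ)) (nhds (C * (((1:ℝ):ℂ)^s))) := by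
    refine Filter.Tendsto.mul Filter.tendsto_fst ?_
    have : ContinuousAt (fun t : ℝ => (t:ℂ)^s) 1 := by
      refine ContinuousAt.cpow Complex.continuous_ofReal.continuousAt continuousAt_const ?_
      simp
    exact Filter.Tendsto.comp this Filter.tendsto_snd
  have hev := (Metric.tendsto_nhds.1 hcont) ε hε
  rw [Filter.eventually_prod_iff] at hev
  obtain ⟨pa, hpa, pb, hpb, hab⟩ := hev
  obtain ⟨δ0, hδ0, hδb⟩ := Metric.eventually_nhds_iff.1 hpb
  set δ := min (δ0/2) (1/2)
  have hδ : 0 < δ := by positivity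
  have hδ1 : δ ≤ 1/2 := min_le_right _ _
  have hδ2 : δ < δ0 := (min_le_left _ _).trans_lt (by linarith)
  obtain ⟨J, hJ⟩ := Filter.eventually_atTop.1 (h.eventually hpa)
  -- exponents
  set r1 := 1 + δ
  set r2 := 1 - δ
  have hr1 : 0 < r1 := by simp only [r1]; linarith
  have hr2 : 0 < r2 := by simp only [r2]; linarith
  have hη : ∃ η : ℝ, 0 < η ∧ η - 1 - r1 * Real.log r1 + Real.exp η * r1 < 0 ∧
      η - 1 - r2 * Real.log r2 + Real.exp η * r2 < 0 := by
    have hc : ∀ r : ℝ, 0 < r → r ≠ 1 → ∀ᶠ η in nhdsWithin (0:ℝ) (Set.Ioi 0),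
        η - 1 - r * Real.log r + Real.exp η * r < 0 := by
      intro r hr hr'
      have hc : Continuous (fun η : ℝ => η - 1 - r * Real.log r + Real.exp η * r) := by fun_prop
      have h0 := hc.tendsto 0
      have hneg : 0 - 1 - r * Real.log r + Real.exp 0 * r < 0 := by
        have := chern_neg hr hr'
        rw [Real.exp_zero]; linarith
      have := h0.eventually (gt_mem_nhds hneg)
      exact this.filter_mono nhdsWithin_le_nhds
    have e1 := hc r1 hr1 (by simp only [r1]; linarith)
    have e2 := hc r2 hr2 (by simp only [r2]; linarith)
    obtain ⟨η, ⟨h1, h2⟩, h3⟩ := ((e1.and e2).and self_mem_nhdsWithin).exists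
    exact ⟨η, h3, h1, h2⟩
  obtain ⟨η, hη, hE1, hE2⟩ := hη
  obtain ⟨K, hK, hKb⟩ := borel_growth h hη
  set L := K + ‖C‖
  have hL : 0 ≤ L := by positivity
  have hexp : ∀ E : ℝ, E < 0 → Filter.Tendsto (fun x : ℝ => Real.exp (x * E)) Filter.atTop (nhds 0) := by
    intro E hE
    exact Real.tendsto_exp_atBot.comp (Filter.tendsto_id.atTop_mul_const_of_neg hE)
  have hsmall : ∀ᶠ x : ℝ in Filter.atTop,
      L * (Real.exp (x * (η - 1 - r1 * Real.log r1 + Real.exp η * r1)) +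
        Real.exp (x * (η - 1 - r2 * Real.log r2 + Real.exp η * r2))) < ε := by
    have := ((hexp _ hE1).add (hexp _ hE2)).const_mul L
    simp only [add_zero, mul_zero] at this
    exact this.eventually (gt_mem_nhds hε)
  have hxs : ∀ᶠ x : ℝ in Filter.atTop, x ^ (-s.re) * Real.exp (-η * x) < 1 :=
    (tendsto_rpow_mul_exp_neg_mul_atTop_nhds_zero (-s.re) η hη).eventually (gt_mem_nhds one_pos)
  filter_upwards [hsmall, hxs, Filter.eventually_gt_atTop 0,
    Filter.eventually_ge_atTop (2 * ((J:ℝ)+1))] with x hx1 hx2 hx0 hxJ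
  have hxs' : ‖(x:ℂ)^(-s)‖ ≤ Real.exp (η * x) := by
    rw [Complex.norm_cpow_eq_rpow_re_of_pos hx0, Complex.neg_re]
    have e : Real.exp (-η * x) * Real.exp (η * x) = 1 := by rw [← Real.exp_add]; simp
    calc x ^ (-s.re) = x ^ (-s.re) * Real.exp (-η * x) * Real.exp (η * x) := by rw [mul_assoc, e, mul_one]
      _ ≤ 1 * Real.exp (η * x) := by gcongr
      _ = _ := one_mul _
  set ℓ1 := Real.log r1
  set ℓ2 := Real.log r2
  have hℓ1 : 0 ≤ ℓ1 := Real.log_nonneg (by simp only [r1]; linarith)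
  have hℓ2 : ℓ2 ≤ 0 := Real.log_nonpos hr2.le (by simp only [r2]; linarith)
  have hpt : ∀ j : ℕ, ‖c j * (x:ℂ)^(-s) - C‖ ≤ ε +
      L * Real.exp (η * x - x * (r1 * ℓ1)) * (Real.exp η * r1)^j +
      L * Real.exp (η * x - x * (r2 * ℓ2)) * (Real.exp η * r2)^j := by
    intro j
    have hterm : ∀ r : ℝ, 0 < r → L * Real.exp (η * x - x * (r * Real.log r)) * (Real.exp η * r)^j =
        L * Real.exp (η * (j + x)) * Real.exp ((j - r * x) * Real.log r) := by
      intro r hr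
      have : Real.exp η * r = Real.exp (η + Real.log r) := by rw [Real.exp_add, Real.exp_log hr]
      rw [this, ← Real.exp_nat_mul, mul_assoc, mul_assoc, ← Real.exp_add, ← Real.exp_add]
      congr 2; ring
    rw [hterm r1 hr1, hterm r2 hr2]
    have hnn1 : 0 ≤ L * Real.exp (η * (j + x)) * Real.exp ((j - r1 * x) * ℓ1) := by positivity
    have hnn2 : 0 ≤ L * Real.exp (η * (j + x)) * Real.exp ((j - r2 * x) * ℓ2) := by positivity
    have hcr : ‖c j * (x:ℂ)^(-s) - C‖ ≤ L * Real.exp (η * (j + x)) := by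
      refine (norm_sub_le _ _).trans ?_
      rw [norm_mul]
      have e1 : ‖c j‖ * ‖(x:ℂ)^(-s)‖ ≤ K * Real.exp (η * j) * Real.exp (η * x) :=
        mul_le_mul (hKb j) hxs' (norm_nonneg _) (by positivity)
      have e2 : Real.exp (η * j) * Real.exp (η * x) = Real.exp (η * (j + x)) := by
        rw [← Real.exp_add]; congr 1; ring
      have e3 : 1 ≤ Real.exp (η * (j + x)) := Real.one_le_exp (by positivity)
      rw [mul_assoc, e2] at e1
      have e4 : ‖C‖ * 1 ≤ ‖C‖ * Real.exp (η * (j + x)) := by gcongr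
      simp only [L]
      nlinarith
    have hLe : 0 ≤ L * Real.exp (η * (j + x)) := by positivity
    by_cases hj1 : r1 * x < j
    · have : 1 ≤ Real.exp ((j - r1 * x) * ℓ1) :=
        Real.one_le_exp (mul_nonneg (by linarith) hℓ1)
      nlinarith
    by_cases hj2 : (j:ℝ) < r2 * x
    · have : 1 ≤ Real.exp ((j - r2 * x) * ℓ2) :=
        Real.one_le_exp (mul_nonneg_of_nonpos_of_nonpos (by linarith) hℓ2)
      nlinarith
    push Not at hj1 hj2
    have hjJ : (J:ℝ) + 1 ≤ j := by
      have : r2 * x ≥ (1/2) * x := by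
        simp only [r2]; nlinarith
      linarith
    have hj0 : (0:ℝ) < j := by
      have : (0:ℝ) ≤ J := by positivity
      linarith
    have hJj : J ≤ j := by
      have : (J:ℝ) ≤ j := by linarith
      exact_mod_cast this
    have ht : dist ((j:ℝ)/x) 1 < δ0 := by
      rw [Real.dist_eq]
      refine lt_of_le_of_lt ?_ hδ2
      rw [abs_le]
      constructor
      · rw [neg_le_sub_iff_le_add, ← sub_le_iff_le_add, le_div_iff₀ hx0]
        simp only [r2] at hj2; linarith
      · rw [sub_le_iff_le_add, div_le_iff₀ hx0]
        simp only [r1] at hj1; linarith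
    have hfin := hab (hJ j hJj) (hδb ht)
    simp only [Complex.ofReal_one, Complex.one_cpow, mul_one] at hfin
    have heq : c j / (j:ℂ)^s * ((((j:ℝ)/x : ℝ)):ℂ)^s = c j * (x:ℂ)^(-s) := by
      have hjne : (j:ℂ)^s ≠ 0 := by
        rw [Complex.cpow_ne_zero_iff]; left; exact_mod_cast hj0.ne'
      have hxne : (x:ℂ)^s ≠ 0 := by
        rw [Complex.cpow_ne_zero_iff]; left; exact_mod_cast hx0.ne'
      have e1 : ((((j:ℝ)/x : ℝ)):ℂ)^s * (x:ℂ)^s = (j:ℂ)^s := by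
        rw [← Complex.mul_cpow_ofReal_nonneg (by positivity) hx0.le, ← Complex.ofReal_mul,
          div_mul_cancel₀ _ hx0.ne']
        simp
      rw [Complex.cpow_neg, ← e1]
      rw [← e1] at hjne
      have htne := left_ne_zero_of_mul hjne
      field_simp
    rw [heq, dist_eq_norm] at hfin
    linarith
  -- summation
  have hmain : (Real.exp (-x) : ℂ) * (x:ℂ)^(-s) * expSer c x - C =
      ∑' j : ℕ, ((Real.exp (-x) * x ^ j / (Nat.factorial j : ℝ) : ℝ) : ℂ) * (c j * (x:ℂ)^(-s) - C) := by
    have s1 := ((borel_geom h).summable (x:ℂ)).hasSum.mul_left ((Real.exp (-x) : ℂ) * (x:ℂ)^(-s))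
    have s2 := (poisson_csum x).mul_right C
    rw [one_mul] at s2
    have s3 := s1.sub s2
    rw [expSer, ← s3.tsum_eq]
    congr 1
    funext j
    push_cast
    ring
  rw [dist_eq_norm, hmain]
  have g1 := (poisson_sum x 1).mul_left ε
  have g2 := (poisson_sum x (Real.exp η * r1)).mul_left (L * Real.exp (η * x - x * (r1 * ℓ1)))
  have g3 := (poisson_sum x (Real.exp η * r2)).mul_left (L * Real.exp (η * x - x * (r2 * ℓ2)))
  have g := (g1.add g2).add g3
  refine lt_of_le_of_lt (tsum_of_norm_bounded g (fun j => ?_)) ?_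
  · have hp : 0 ≤ Real.exp (-x) * x ^ j / (Nat.factorial j : ℝ) := by positivity
    rw [norm_mul, Complex.norm_real, Real.norm_eq_abs, abs_of_nonneg hp]
    refine (mul_le_mul_of_nonneg_left (hpt j) hp).trans (le_of_eq ?_)
    rw [one_pow]; ring
  · have q1 : Real.exp (-x) * Real.exp (x * 1) = 1 := by rw [← Real.exp_add]; simp
    have q2 : ∀ r ℓ : ℝ, L * Real.exp (η * x - x * (r * ℓ)) * (Real.exp (-x) * Real.exp (x * (Real.exp η * r))) =
        L * Real.exp (x * (η - 1 - r * ℓ + Real.exp η * r)) := by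
      intro r ℓ
      rw [mul_assoc, ← Real.exp_add, ← Real.exp_add]
      congr 2; ring
    rw [q1, q2, q2]
    simp only [ε] at hx1 ⊢
    linarith


/-- Kummer coefficients. -/
noncomputable def kc (a b : ℂ) (j : ℕ) : ℂ :=
  Polynomial.eval a (ascPochhammer ℂ j) / Polynomial.eval b (ascPochhammer ℂ j)

theorem poch_prod (s : ℂ) (n : ℕ) :
    Polynomial.eval s (ascPochhammer ℂ n) = ∏ j ∈ Finset.range n, (s + j) := by
  induction n with
  | zero => simp
  | succ n ih => rw [ascPochhammer_succ_eval, ih, Finset.prod_range_succ]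

theorem poch_ne {b : ℂ} (hb : ∀ n : ℕ, b ≠ -n) (n : ℕ) :
    Polynomial.eval b (ascPochhammer ℂ n) ≠ 0 := by
  rw [poch_prod]
  refine Finset.prod_ne_zero_iff.2 (fun j _ h => hb j ?_)
  linear_combination h

theorem kc_zero (a b : ℂ) : kc a b 0 = 1 := by simp [kc]

theorem kc_succ (a : ℂ) {b : ℂ} (hb : ∀ n : ℕ, b ≠ -n) (j : ℕ) :
    kc a b (j+1) * (b + j) = (a + j) * kc a b j := by
  have h1 := poch_ne hb j
  have h2 : b + j ≠ 0 := fun h => hb j (by linear_combination h)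
  simp only [kc, ascPochhammer_succ_eval]
  field_simp

theorem kc_asymp (a : ℂ) {b : ℂ} (hb : ∀ n : ℕ, b ≠ -n) :
    Filter.Tendsto (fun j : ℕ => kc a b (j+1) / (j:ℂ)^(a-b)) Filter.atTop
      (nhds (Complex.Gamma b / Complex.Gamma a)) ∧
    Filter.Tendsto (fun j : ℕ => kc a b j / (j:ℂ)^(a-b)) Filter.atTop
      (nhds (Complex.Gamma b / Complex.Gamma a)) := by
  by_cases ha : ∃ m : ℕ, a = -m
  · obtain ⟨m, rfl⟩ := ha
    rw [Complex.Gamma_neg_nat_eq_zero, div_zero]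
    constructor
    · refine Filter.Tendsto.congr' ?_ tendsto_const_nhds
      filter_upwards [Filter.eventually_gt_atTop m] with j hj
      rw [kc, ascPochhammer_eval_neg_coe_nat_of_lt (by omega)]; simp
    · refine Filter.Tendsto.congr' ?_ tendsto_const_nhds
      filter_upwards [Filter.eventually_gt_atTop m] with j hj
      rw [kc, ascPochhammer_eval_neg_coe_nat_of_lt (by omega)]; simp
  · push Not at ha
    have h1 : Filter.Tendsto (fun j : ℕ => kc a b (j+1) / (j:ℂ)^(a-b)) Filter.atTop
        (nhds (Complex.Gamma b / Complex.Gamma a)) := by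
      have h := (Complex.GammaSeq_tendsto_Gamma b).div (Complex.GammaSeq_tendsto_Gamma a)
        (Complex.Gamma_ne_zero ha)
      refine h.congr' ?_
      filter_upwards [Filter.eventually_gt_atTop 0] with j hj
      have hj0 : (j:ℂ) ≠ 0 := by exact_mod_cast hj.ne'
      have e1 := poch_ne hb (j+1)
      have e2 := poch_ne ha (j+1)
      have e3 : (j:ℂ)^a ≠ 0 := by rw [Complex.cpow_ne_zero_iff]; left; exact hj0
      have e4 : (j:ℂ)^b ≠ 0 := by rw [Complex.cpow_ne_zero_iff]; left; exact hj0
      have e5 : (Nat.factorial j : ℂ) ≠ 0 := by exact_mod_cast Nat.factorial_ne_zero j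
      simp only [Pi.div_apply, Complex.GammaSeq, kc, ← poch_prod]
      rw [Complex.cpow_sub _ _ hj0]
      field_simp
    refine ⟨h1, ?_⟩
    have h2 : Filter.Tendsto (fun j : ℕ => (b + j) / (a + j)) Filter.atTop (nhds 1) := by
      have h3 : Filter.Tendsto (fun j : ℕ => 1 + (b - a) * (a + j)⁻¹) Filter.atTop (nhds (1 + (b-a) * 0)) := by
        refine tendsto_const_nhds.add (Filter.Tendsto.const_mul _ ?_)
        apply Filter.tendsto_inv₀_cobounded.comp
        have : Filter.Tendsto (fun j : ℕ => (j:ℂ)) Filter.atTop (Bornology.cobounded ℂ) := by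
          rw [← tendsto_norm_atTop_iff_cobounded]
          simpa using tendsto_natCast_atTop_atTop (R := ℝ)
        exact (tendsto_const_add_cobounded a).comp this
      rw [mul_zero, add_zero] at h3
      refine h3.congr (fun j => ?_)
      have : a + j ≠ 0 := fun h => ha j (by linear_combination h)
      field_simp
      ring
    have h4 := h1.mul h2
    rw [mul_one] at h4
    refine h4.congr (fun j => ?_)
    have : a + j ≠ 0 := fun h => ha j (by linear_combination h)
    have h5 := kc_succ a hb j
    rw [div_mul_div_comm, h5]
    rw [mul_comm (a + (j:ℂ)), mul_div_mul_right _ _ this]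

theorem expSer_zero (c : ℕ → ℂ) : expSer c 0 = c 0 := by
  rw [expSer, tsum_eq_single 0]
  · simp
  · intro j hj; simp [hj]

theorem kummer_ode (a : ℂ) {b : ℂ} (hb : ∀ n : ℕ, b ≠ -n) (z : ℂ) :
    z * expSer (fun j => kc a b (j+1+1)) z =
      a * expSer (kc a b) z - (b - z) * expSer (fun j => kc a b (j+1)) z := by
  have hg := borel_geom (kc_asymp a hb).2
  have s1 := expSer_nat_mul hg.shift z
  have s2 := expSer_nat_mul hg z
  have s3 := (hg.summable z).hasSum.mul_left a
  have s4 := (hg.shift.summable z).hasSum.mul_left b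
  have s5 := (s1.add s4).sub (s2.add s3)
  have s6 : HasSum (fun _ : ℕ => (0:ℂ)) (z * expSer (fun j => kc a b (j+1+1)) z + b * expSer (fun j => kc a b (j+1)) z -
      (z * expSer (fun j => kc a b (j+1)) z + a * expSer (kc a b) z)) := by
    refine Eq.mp (congrArg (fun q => HasSum q _) (funext fun j => ?_)) s5
    have := kc_succ a hb j
    linear_combination (z ^ j / (Nat.factorial j : ℂ)) * this
  have := s6.unique hasSum_zero
  linear_combination this

theorem wronsk_M (κ μ : ℂ) (hp : ∀ n : ℕ, 2*μ+1 ≠ -n) (hm : ∀ n : ℕ, 2*(-μ)+1 ≠ -n) (z : ℂ) :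
    Complex.exp (-z) * (-2*μ * (expSer (kc (1/2-κ+μ) (2*μ+1)) z * expSer (kc (1/2-κ+-μ) (2*(-μ)+1)) z) +
      z * (expSer (kc (1/2-κ+μ) (2*μ+1)) z * expSer (fun j => kc (1/2-κ+-μ) (2*(-μ)+1) (j+1)) z -
        expSer (fun j => kc (1/2-κ+μ) (2*μ+1) (j+1)) z * expSer (kc (1/2-κ+-μ) (2*(-μ)+1)) z)) = -2*μ := by
  set cp := kc (1/2-κ+μ) (2*μ+1)
  set cm := kc (1/2-κ+-μ) (2*(-μ)+1)
  have gp : GeomBdd cp := borel_geom (kc_asymp _ hp).2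
  have gm : GeomBdd cm := borel_geom (kc_asymp _ hm).2
  set Kf : ℂ → ℂ := fun z => Complex.exp (-z) * (-2*μ * (expSer cp z * expSer cm z) +
      z * (expSer cp z * expSer (fun j => cm (j+1)) z - expSer (fun j => cp (j+1)) z * expSer cm z))
  have hK : ∀ z, HasDerivAt Kf 0 z := by
    intro z
    have d0 : HasDerivAt (fun z => Complex.exp (-z)) (-Complex.exp (-z)) z := by
      simpa using (hasDerivAt_neg z).cexp
    have p1 := expSer_hasDerivAt gp z
    have p2 := expSer_hasDerivAt gp.shift z
    have m1 := expSer_hasDerivAt gm z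
    have m2 := expSer_hasDerivAt gm.shift z
    have D := d0.mul (((p1.mul m1).const_mul (-2*μ)).add ((hasDerivAt_id z).mul ((p1.mul m2).sub (p2.mul m1))))
    refine HasDerivAt.congr_deriv (f := Kf) D ?_
    have op := kummer_ode (1/2-κ+μ) hp z
    have om := kummer_ode (1/2-κ+-μ) hm z
    simp only [Pi.mul_apply, Pi.add_apply, Pi.sub_apply, id]
    linear_combination (Complex.exp (-z) * expSer cp z) * om - (Complex.exp (-z) * expSer cm z) * op
  have hc := is_const_of_deriv_eq_zero (fun z => (hK z).differentiableAt) (fun z => (hK z).deriv) z 0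
  have h0 : Kf 0 = -2*μ := by
    simp [Kf, expSer_zero, cp, cm, kc_zero]
  exact hc.trans h0

theorem wronsk_D (κ : ℝ) {x0 : ℝ} (h0 : 0 < x0) (a b l : ℂ) (hb : ∀ n : ℕ, b ≠ -n)
    (h1 : b = 2*a + 2*κ) (h2 : l = a*(b-a-1)) :
    (Real.exp (-x0) : ℂ) * (x0:ℂ)^(-(a-b)) *
      (sfun κ (fun n => l^n) x0 * expSer (fun j => kc a b (j+1)) x0 -
        sder κ (fun n => l^n) x0 * expSer (kc a b) x0 +
        a / x0 * (sfun κ (fun n => l^n) x0 * expSer (kc a b) x0)) =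
      Complex.Gamma b / Complex.Gamma a := by
  obtain ⟨-, -, hf, hd, lf, ld⟩ := sfun_all κ (half_pos h0) (geom_pow l)
  have hsh : ∀ x, sfun κ (fun n => l ^ (n+1)) x = l * sfun κ (fun n => l ^ n) x := by
    intro x
    simp only [sfun, ← tsum_mul_left]
    congr 1; funext n; ring
  simp only [hsh] at hd
  set f := sfun κ (fun n => l ^ n)
  set d := sder κ (fun n => l ^ n)
  obtain ⟨T1, T0⟩ := kc_asymp a hb
  have hg := borel_geom T0
  have A1 := borel_asymp T1
  have A0 := borel_asymp T0
  set H : ℝ → ℂ := fun x => (Real.exp (-x) : ℂ) * (x:ℂ)^(-(a-b)) *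
      (f x * expSer (fun j => kc a b (j+1)) x - d x * expSer (kc a b) x +
        a / x * (f x * expSer (kc a b) x))
  have hlim : Filter.Tendsto H Filter.atTop (nhds (Complex.Gamma b / Complex.Gamma a)) := by
    have hi : Filter.Tendsto (fun x : ℝ => a / (x:ℂ)) Filter.atTop (nhds 0) := by
      have := (Complex.continuous_ofReal.tendsto 0).comp (tendsto_inv_atTop_zero (𝕜 := ℝ))
      have h2 := this.const_mul a
      simpa [div_eq_mul_inv, Function.comp_def] using h2
    have T := ((lf.mul A1).sub (ld.mul A0)).add (hi.mul (lf.mul A0))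
    simp only [pow_zero, one_mul, zero_mul, sub_zero, add_zero] at T
    refine T.congr (fun x => ?_)
    simp only [H]
    ring
  have hder : ∀ x ∈ Set.Ioi (x0/2), HasDerivAt H 0 x := by
    intro x hx
    have hx0 : 0 < x := (half_pos h0).trans hx
    have hxc : (x:ℂ) ≠ 0 := by exact_mod_cast hx0.ne'
    have d0 : HasDerivAt (fun x : ℝ => (Real.exp (-x) : ℂ)) (-(Real.exp (-x) : ℂ)) x := by
      have d1 : HasDerivAt (fun x : ℝ => Real.exp (-x)) (-Real.exp (-x)) x := by
        simpa using (hasDerivAt_neg x).exp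
      simpa using d1.ofReal_comp
    have d2 : HasDerivAt (fun x : ℝ => (x:ℂ)^(-(a-b))) (-(a-b) * (x:ℂ)^(-(a-b)) / x) x := by
      have hs : (x:ℂ) ∈ Complex.slitPlane := Complex.ofReal_mem_slitPlane.2 hx0
      have := ((hasDerivAt_id (x:ℂ)).cpow_const (c := -(a-b)) hs).comp_ofReal
      refine this.congr_deriv ?_
      simp only [id]
      rw [Complex.cpow_sub _ _ hxc, Complex.cpow_one]
      ring
    have e0 := (expSer_hasDerivAt hg (x:ℂ)).comp_ofReal
    have e1 := (expSer_hasDerivAt hg.shift (x:ℂ)).comp_ofReal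
    have d3 : HasDerivAt (fun x : ℝ => a / (x:ℂ)) (-a / x^2) x := by
      have := ((hasDerivAt_inv hxc).const_mul a).comp_ofReal
      simp only [← div_eq_mul_inv] at this
      refine this.congr_deriv ?_
      ring
    have D := (d0.mul d2).mul ((((hf x hx).mul e1).sub ((hd x hx).mul e0)).add (d3.mul ((hf x hx).mul e0)))
    refine HasDerivAt.congr_deriv (f := H) D ?_
    have ode := kummer_ode a hb (x:ℂ)
    have ode2 : expSer (fun j => kc a b (j+1+1)) x =
      (a * expSer (kc a b) x - (b - x) * expSer (fun j => kc a b (j+1)) x) / x := by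
      rw [← ode]; field_simp
    simp only [Pi.mul_apply, Pi.add_apply, Pi.sub_apply]
    rw [ode2, h2, h1]
    field_simp
    ring
  have hconst : ∀ x, x0/2 < x → H x = H x0 := by
    intro x hx
    exact isOpen_Ioi.is_const_of_deriv_eq_zero isPreconnected_Ioi
      (fun y hy => (hder y hy).differentiableAt.differentiableWithinAt)
      (fun y hy => (hder y hy).deriv) hx (by simp [h0])
  have hl2 : Filter.Tendsto H Filter.atTop (nhds (H x0)) := by
    refine Filter.Tendsto.congr' ?_ tendsto_const_nhds
    filter_upwards [Filter.eventually_gt_atTop (x0/2)] with x hx using (hconst x hx).symm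
  exact tendsto_nhds_unique hl2 hlim

theorem whittakerM_eq (κ μ : ℂ) (x : ℝ) : whittakerM κ μ x =
    Complex.exp (-(x:ℂ)/2) * Complex.exp ((1/2 + μ) * (Real.log x : ℂ)) *
      expSer (kc (1/2-κ+μ) (2*μ+1)) x := by
  rw [whittakerM, expSer]
  congr 1
  congr 1
  funext j
  rw [kc]
  ring

theorem connection (κ : ℝ) {x0 : ℝ} (h0 : 0 < x0) (μ : ℂ) (hμ : ∀ n : ℤ, 2*μ ≠ (n:ℂ)) :
    whittakerW (κ:ℂ) μ x0 = Complex.exp (-(x0:ℂ)/2) * Complex.exp (κ * (Real.log x0 : ℂ)) *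
      sfun κ (fun n => (μ^2 - (κ - 1/2)^2)^n) x0 := by
  have hp : ∀ n : ℕ, 2*μ+1 ≠ -n := by
    intro n h
    refine hμ (-n-1) ?_
    push_cast; linear_combination h
  have hm : ∀ n : ℕ, 2*(-μ)+1 ≠ -n := by
    intro n h
    refine hμ (n+1) ?_
    push_cast; linear_combination -h
  have hμ0 : μ ≠ 0 := fun h => hμ 0 (by simp [h])
  have hW := wronsk_M κ μ hp hm x0
  have hDp := wronsk_D κ h0 (1/2-κ+μ) (2*μ+1) (μ^2 - (κ - 1/2)^2) hp (by ring) (by ring)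
  have hDm := wronsk_D κ h0 (1/2-κ+-μ) (2*(-μ)+1) (μ^2 - (κ - 1/2)^2) hm (by ring) (by ring)
  have hx0 : (x0:ℂ) ≠ 0 := by exact_mod_cast h0.ne'
  have hG1 : Complex.Gamma (2*μ+1) = 2*μ * Complex.Gamma (2*μ) :=
    Complex.Gamma_add_one _ (by simpa using hμ0)
  have hG2 : Complex.Gamma (2*(-μ)+1) = -(2*μ) * Complex.Gamma (-(2*μ)) := by
    have := Complex.Gamma_add_one (-(2*μ)) (by simpa using hμ0)
    rw [← this]; congr 1; ring
  rw [hG1] at hDp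
  rw [hG2] at hDm
  rw [whittakerW, whittakerM_eq, whittakerM_eq]
  have hA : Complex.Gamma (-(2*μ)) / Complex.Gamma (1/2 - κ - μ) =
      (-(2*μ))⁻¹ * (-(2*μ) * Complex.Gamma (-(2*μ)) / Complex.Gamma (1/2-κ+-μ)) := by
    have : -(2*μ) ≠ 0 := by simpa using hμ0
    rw [mul_div_assoc, inv_mul_cancel_left₀ this, sub_eq_add_neg (1/2 - (κ:ℂ)) μ]
  have hB : Complex.Gamma (2*μ) / Complex.Gamma (1/2 - κ + μ) =
      (2*μ)⁻¹ * (2*μ * Complex.Gamma (2*μ) / Complex.Gamma (1/2-κ+μ)) := by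
    have : 2*μ ≠ 0 := by simpa using hμ0
    rw [mul_div_assoc, inv_mul_cancel_left₀ this]
  rw [hA, hB, ← hDp, ← hDm]
  set f := sfun κ (fun n => (μ^2 - (κ - 1/2)^2)^n) x0
  set d := sder κ (fun n => (μ^2 - (κ - 1/2)^2)^n) x0
  set P := expSer (kc (1/2-κ+μ) (2*μ+1)) x0
  set M := expSer (kc (1/2-κ+-μ) (2*(-μ)+1)) x0
  set P1 := expSer (fun j => kc (1/2-κ+μ) (2*μ+1) (j+1)) x0
  set M1 := expSer (fun j => kc (1/2-κ+-μ) (2*(-μ)+1) (j+1)) x0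
  have hlog : Complex.log (x0:ℂ) = (Real.log x0 : ℂ) := (Complex.ofReal_log h0.le).symm
  rw [Complex.cpow_def_of_ne_zero hx0, Complex.cpow_def_of_ne_zero hx0, hlog]
  set L := (Real.log x0 : ℂ)
  have hxL : Complex.exp L = x0 := by rw [← hlog, Complex.exp_log hx0]
  have E1 : Complex.exp (L * -(1/2-κ+μ - (2*μ+1))) * Complex.exp ((1/2 + -μ) * L) = Complex.exp (κ * L) * x0 := by
    rw [← hxL, ← Complex.exp_add, ← Complex.exp_add]; congr 1; ring
  have E2 : Complex.exp (L * -(1/2-κ+-μ - (2*(-μ)+1))) * Complex.exp ((1/2 + μ) * L) = Complex.exp (κ * L) * x0 := by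
    rw [← hxL, ← Complex.exp_add, ← Complex.exp_add]; congr 1; ring
  have hexp : (Real.exp (-x0) : ℂ) = Complex.exp (-(x0:ℂ)) := by push_cast; rfl
  rw [hexp]
  set ex := Complex.exp (-(x0:ℂ))
  set eh := Complex.exp (-(x0:ℂ)/2)
  set Q1 := Complex.exp (L * -(1/2-κ+μ - (2*μ+1)))
  set Q2 := Complex.exp (L * -(1/2-κ+-μ - (2*(-μ)+1)))
  set R1 := Complex.exp ((1/2 + -μ) * L)
  set R2 := Complex.exp ((1/2 + μ) * L)
  set X := Complex.exp (κ * L)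
  have goal1 : (-(2*μ))⁻¹ * (ex * Q2 * (f * M1 - d * M + (1/2-κ+-μ) / x0 * (f * M))) * (eh * R2 * P) +
      (2*μ)⁻¹ * (ex * Q1 * (f * P1 - d * P + (1/2-κ+μ) / x0 * (f * P))) * (eh * R1 * M) =
      (2*μ)⁻¹ * eh * ex * ((Q1 * R1) * (f * P1 - d * P + (1/2-κ+μ) / x0 * (f * P)) * M -
        (Q2 * R2) * (f * M1 - d * M + (1/2-κ+-μ) / x0 * (f * M)) * P) := by
    rw [inv_neg]; ring
  rw [goal1, E1, E2]
  have goal2 : (2*μ)⁻¹ * eh * ex * ((X * x0) * (f * P1 - d * P + (1/2-κ+μ) / x0 * (f * P)) * M -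
        (X * x0) * (f * M1 - d * M + (1/2-κ+-μ) / x0 * (f * M)) * P) =
      (2*μ)⁻¹ * eh * X * f * (-(ex * (-2*μ*(P*M) + x0 * (P * M1 - P1 * M)))) := by
    field_simp
    ring
  rw [goal2, hW]
  field_simp


/-- Taylor data of the spectral function. -/
noncomputable def gco (κ x0 : ℝ) (n : ℕ) : ℂ := (Nat.factorial n : ℂ) * (fs κ n x0 : ℂ)

theorem gco_geom (κ : ℝ) {x0 : ℝ} (h0 : 0 < x0) : GeomBdd (gco κ x0) := by
  obtain ⟨K, hK, -, -, -, hfb, -⟩ := volterra_seq κ (half_pos h0)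
  refine ⟨1, K / x0, zero_le_one, by positivity, fun n => ?_⟩
  have hb := hfb n x0 (half_lt_self h0)
  have hn : (0:ℝ) < Nat.factorial n := by exact_mod_cast Nat.factorial_pos n
  rw [gco, norm_mul, Complex.norm_natCast, Complex.norm_real, Real.norm_eq_abs]
  calc (Nat.factorial n : ℝ) * |fs κ n x0|
      ≤ Nat.factorial n * (K^n / (Nat.factorial n : ℝ) * (1/x0)^n) := by gcongr
    _ = 1 * (K / x0)^n := by
      rw [one_div, inv_pow, div_pow]
      field_simp

theorem sfun_pow_eq (κ x0 : ℝ) (l : ℂ) : sfun κ (fun n => l^n) x0 = expSer (gco κ x0) l := by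
  rw [sfun, expSer]
  congr 1
  funext n
  have hn : (Nat.factorial n : ℂ) ≠ 0 := by exact_mod_cast Nat.factorial_ne_zero n
  rw [gco]
  field_simp

theorem sfun_dpow_eq (κ : ℝ) {x0 : ℝ} (h0 : 0 < x0) (l : ℂ) :
    sfun κ (fun n => (n:ℂ) * l^(n-1)) x0 = expSer (fun n => gco κ x0 (n+1)) l := by
  have hs := (sfun_all κ (half_pos h0) (geom_dpow l)).1 x0 (half_lt_self h0)
  rw [sfun, expSer, hs.tsum_eq_zero_add]
  simp only [Nat.cast_zero, zero_mul, zero_add, Nat.add_sub_cancel]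
  congr 1
  funext n
  have hn : (Nat.factorial n : ℂ) ≠ 0 := by exact_mod_cast Nat.factorial_ne_zero n
  rw [gco, Nat.factorial_succ]
  push_cast
  field_simp

/-- All zeros of the entire function `μ ↦ W_{κ,μ}(x₀)` are simple, except for a
possible double zero at `μ = 0`. -/
theorem stmt_15 (κ x₀ : ℝ) (hx : 0 < x₀) (F : ℂ → ℂ) (hF : Differentiable ℂ F)
    (hFW : ∀ μ : ℂ, (∀ n : ℤ, 2*μ ≠ (n:ℂ)) → F μ = whittakerW (κ:ℂ) μ x₀) :
    (∀ ρ : ℂ, F ρ = 0 → ρ ≠ 0 → deriv F ρ ≠ 0) ∧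
    (F 0 = 0 → deriv (deriv F) 0 ≠ 0) := by
  set E : ℂ := Complex.exp (-(x₀:ℂ)/2) * Complex.exp (κ * (Real.log x₀ : ℂ))
  have hE : E ≠ 0 := mul_ne_zero (Complex.exp_ne_zero _) (Complex.exp_ne_zero _)
  have gg := gco_geom κ hx
  set g := gco κ x₀ with hg
  set c : ℂ := ((κ:ℂ) - 1/2)^2
  set H : ℂ → ℂ := fun μ => E * expSer g (μ^2 - c) with hH
  have hq : ∀ μ : ℂ, HasDerivAt (fun μ : ℂ => μ^2 - c) (2*μ) μ := by
    intro μ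
    simpa using (hasDerivAt_pow 2 μ).sub_const c
  have hHd : ∀ μ, HasDerivAt H (E * (expSer (fun n => g (n+1)) (μ^2-c) * (2*μ))) μ := by
    intro μ
    exact ((expSer_hasDerivAt gg (μ^2-c)).comp μ (hq μ)).const_mul E
  have hHdiff : Differentiable ℂ H := fun μ => (hHd μ).differentiableAt
  have hFH : F = H := by
    refine AnalyticOnNhd.eq_of_eventuallyEq (z₀ := 1/4) (fun z _ => hF.analyticAt z)
      (fun z _ => hHdiff.analyticAt z) ?_
    filter_upwards [Metric.ball_mem_nhds (1/4 : ℂ) (show (0:ℝ) < 1/8 by norm_num)] with μ hμ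
    have hni : ∀ n : ℤ, 2*μ ≠ (n:ℂ) := by
      intro n hn
      rw [Metric.mem_ball, dist_eq_norm] at hμ
      have h1 := (Complex.abs_re_le_norm (μ - 1/4)).trans_lt hμ
      have h2 : 2 * μ.re = n := by simpa using congrArg Complex.re hn
      have h3 : (μ - 1/4).re = μ.re - 1/4 := by simp
      rw [h3, abs_lt] at h1
      have h4 : (0:ℝ) < n := by linarith
      have h5 : (n:ℝ) < 1 := by linarith
      have h6 : 0 < n := by exact_mod_cast h4
      have h7 : n < 1 := by exact_mod_cast h5
      omega
    rw [hFW μ hni, connection κ hx μ hni, sfun_pow_eq]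
  have key : ∀ ρ, F ρ = 0 → expSer (fun n => g (n+1)) (ρ^2-c) ≠ 0 := by
    intro ρ hρ
    rw [hFH] at hρ
    have hz : expSer g (ρ^2-c) = 0 := (mul_eq_zero.mp hρ).resolve_left hE
    rw [hg, ← sfun_dpow_eq κ hx]
    exact zero_simple κ hx _ (by rw [sfun_pow_eq]; exact hz)
  constructor
  · intro ρ hρ h0
    rw [hFH, (hHd ρ).deriv]
    exact mul_ne_zero hE (mul_ne_zero (key ρ hρ) (mul_ne_zero two_ne_zero h0))
  · intro h0
    have hd : deriv F = fun μ => E * (expSer (fun n => g (n+1)) (μ^2-c) * (2*μ)) := by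
      funext μ
      rw [hFH, (hHd μ).deriv]
    have h2 := (((expSer_hasDerivAt gg.shift ((0:ℂ)^2-c)).comp (0:ℂ) (hq 0)).mul
      ((hasDerivAt_id (0:ℂ)).const_mul 2)).const_mul E
    have h3 := h2.deriv
    rw [hd]
    refine ne_of_eq_of_ne h3 ?_
    have := key 0 h0
    simpa using ⟨hE, by simpa using this⟩
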